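/- Assume the points (x_1,…,x_n) are i.i.d. samples from ν = wμ, where the density w satisfies K_{w,m} = sup_{x ∈ 𝒳} w(x)^{-1} ‖𝛗(x)‖₂² < ∞. Then for any 0 < δ < 1: P(λ_min(G^w) < 1 − δ) ≤ m·exp(−n·c_δ / K_{w,m}), where c_δ = δ + (1−δ)log(1−δ). Consequently P(λ_min(G^w) < 1−δ) ≤ η whenever n ≥ c_δ^{-1} K_{w,m} log(m η^{-1}). -/

import Mathlib

open MeasureTheory ProbabilityTheory Matrix Finset
open scoped ENNReal NNReal BigOperators RealInnerProductSpace

noncomputable section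

namespace WLSDPP

variable {𝓧 : Type*} [MeasurableSpace 𝓧]

/-- Smallest eigenvalue of a real symmetric matrix, via the Rayleigh quotient. -/
def lambdaMin {m : ℕ} (A : Matrix (Fin m) (Fin m) ℝ) : ℝ :=
  ⨅ v : {v : Fin m → ℝ // ∑ i, v i ^ 2 = 1}, (v : Fin m → ℝ) ⬝ᵥ A.mulVec v

/-- The feature vector `𝛗(x) = (φ₁(x),…,φ_m(x))ᵀ`. -/
def feat {m : ℕ} (φ : Fin m → 𝓧 → ℝ) (x : 𝓧) : Fin m → ℝ := fun j => φ j x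

/-- Empirical Gram matrix `G^w(x) = (1/n) ∑ᵢ w(xᵢ)⁻¹ 𝛗(xᵢ)𝛗(xᵢ)ᵀ`. -/
def gram {m n : ℕ} (φ : Fin m → 𝓧 → ℝ) (w : 𝓧 → ℝ) (x : Fin n → 𝓧) :
    Matrix (Fin m) (Fin m) ℝ :=
  (n : ℝ)⁻¹ • ∑ i, (w (x i))⁻¹ • vecMulVec (feat φ (x i)) (feat φ (x i))

/-- Empirical seminorm squared `‖f‖ₙ² = (1/n) ∑ᵢ w(xᵢ)⁻¹ f(xᵢ)²`. -/
def empSq {n : ℕ} (w : 𝓧 → ℝ) (f : 𝓧 → ℝ) (x : Fin n → 𝓧) : ℝ :=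
  (n : ℝ)⁻¹ * ∑ i, (w (x i))⁻¹ * f (x i) ^ 2

/-- Squared L²(μ) norm. -/
def l2Sq (μ : Measure 𝓧) (f : 𝓧 → ℝ) : ℝ := ∫ y, f y ^ 2 ∂μ

/-- L²(μ) norm. -/
def l2 (μ : Measure 𝓧) (f : 𝓧 → ℝ) : ℝ := Real.sqrt (l2Sq μ f)

/-- The element of `V_m` with coefficient vector `a`. -/
def lin {m : ℕ} (φ : Fin m → 𝓧 → ℝ) (a : Fin m → ℝ) : 𝓧 → ℝ := fun y => ∑ j, a j * φ j y

/-- The L²(μ)-orthogonal projection onto `V_m` (for `φ` an orthonormal basis of `V_m`). -/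
def projV {m : ℕ} (μ : Measure 𝓧) (φ : Fin m → 𝓧 → ℝ) (f : 𝓧 → ℝ) : 𝓧 → ℝ :=
  lin φ (fun j => ∫ y, φ j y * f y ∂μ)

/-- The right-hand side vector `b = (1/n) ∑ᵢ w(xᵢ)⁻¹ f(xᵢ) 𝛗(xᵢ)`. -/
def bVec {m n : ℕ} (φ : Fin m → 𝓧 → ℝ) (w : 𝓧 → ℝ) (f : 𝓧 → ℝ) (x : Fin n → 𝓧) :
    Fin m → ℝ :=
  (n : ℝ)⁻¹ • ∑ i, ((w (x i))⁻¹ * f (x i)) • feat φ (x i)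

/-- The weighted least-squares projection `P̂_{V_m} f = 𝛗(·)ᵀ (G^w)⁻¹ b`. -/
def lsProj {m n : ℕ} (φ : Fin m → 𝓧 → ℝ) (w : 𝓧 → ℝ) (f : 𝓧 → ℝ) (x : Fin n → 𝓧) :
    𝓧 → ℝ :=
  lin φ ((gram φ w x)⁻¹ *ᵥ bVec φ w f x)

/-- The measure with density `w` with respect to `μ`. -/
def dens (μ : Measure 𝓧) (w : 𝓧 → ℝ) : Measure 𝓧 :=
  μ.withDensity fun a => ENNReal.ofReal (w a)

/-- The inverse Christoffel density `w_m(x) = (1/m) ‖𝛗(x)‖₂²`. -/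
def wChr {m : ℕ} (φ : Fin m → 𝓧 → ℝ) : 𝓧 → ℝ := fun x => (m : ℝ)⁻¹ * ∑ i, φ i x ^ 2

/-- The feature matrix `Φ(x)` with `i`-th row `𝛗(xᵢ)ᵀ`. -/
def featM {m n : ℕ} (φ : Fin m → 𝓧 → ℝ) (x : Fin n → 𝓧) : Matrix (Fin n) (Fin m) ℝ :=
  Matrix.of fun i j => φ j (x i)

/-- The weighted feature matrix `Φ^w(x)` with `i`-th row `w(xᵢ)^{-1/2} 𝛗(xᵢ)ᵀ`. -/
def featW {m n : ℕ} (φ : Fin m → 𝓧 → ℝ) (w : 𝓧 → ℝ) (x : Fin n → 𝓧) :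
    Matrix (Fin n) (Fin m) ℝ :=
  Matrix.of fun i j => (Real.sqrt (w (x i)))⁻¹ * φ j (x i)

/-- The projection DPP `γ_m`, with density `(1/m!) det(Φ(x)ᵀΦ(x))` w.r.t. `μ^⊗m`. -/
def dpp {m : ℕ} (μ : Measure 𝓧) (φ : Fin m → 𝓧 → ℝ) : Measure (Fin m → 𝓧) :=
  (Measure.pi fun _ : Fin m => μ).withDensity fun x =>
    ENNReal.ofReal ((m.factorial : ℝ)⁻¹ * ((featM φ x)ᵀ * featM φ x).det)

/-- The generalized volume sampling distribution `γ_n^ν`, `ν = wμ`, with density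
`n^m ((n−m)!/n!) det(G^w(x))` with respect to `ν^⊗n`. -/
def vs {m : ℕ} (μ : Measure 𝓧) (φ : Fin m → 𝓧 → ℝ) (w : 𝓧 → ℝ) (n : ℕ) :
    Measure (Fin n → 𝓧) :=
  (Measure.pi fun _ : Fin n => dens μ w).withDensity fun x =>
    ENNReal.ofReal ((n : ℝ) ^ m * ((n - m).factorial : ℝ) / (n.factorial : ℝ) *
      (gram φ w x).det)

/-- `c_δ = δ + (1−δ) log(1−δ)`. -/
def cDelta (δ : ℝ) : ℝ := δ + (1 - δ) * Real.log (1 - δ)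

/-- `φ₁, …, φ_m` is an orthonormal system in `L²_μ`. -/
def IsONB {m : ℕ} (μ : Measure 𝓧) (φ : Fin m → 𝓧 → ℝ) : Prop :=
  ∀ i j, ∫ y, φ i y * φ j y ∂μ = if i = j then (1 : ℝ) else 0

end WLSDPP

namespace WLSDPP

theorem one_sub_half_le_exp_neg_mul {t : ℝ} (ht : 0 ≤ t) :
    1 - t / 2 ≤ Real.exp (-t) * (1 + t / 2) := by
  have hd : ∀ s : ℝ, HasDerivAt (fun s : ℝ => Real.exp (-s) * (1 + s / 2) + s / 2)
      (1 / 2 * (1 - Real.exp (-s) * (1 + s))) s := by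
    intro s
    have h1 : HasDerivAt (fun s : ℝ => Real.exp (-s)) (Real.exp (-s) * (-1)) s :=
      (hasDerivAt_neg s).exp
    have h2 : HasDerivAt (fun s : ℝ => s / 2) (1 / 2) s := (hasDerivAt_id s).div_const 2
    exact ((h1.mul (h2.const_add 1)).add h2).congr_deriv (by ring)
  have hmono : MonotoneOn (fun s : ℝ => Real.exp (-s) * (1 + s / 2) + s / 2) (Set.Ici 0) := by
    refine monotoneOn_of_deriv_nonneg (convex_Ici 0)
      (fun s _ => (hd s).continuousAt.continuousWithinAt)
      (fun s _ => (hd s).differentiableAt.differentiableWithinAt) fun s _ => ?_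
    rw [(hd s).deriv]
    have h1 : Real.exp (-s) * (1 + s) ≤ Real.exp (-s) * Real.exp s := by
      gcongr
      linarith [Real.add_one_le_exp s]
    rw [← Real.exp_add] at h1
    simp only [neg_add_cancel, Real.exp_zero] at h1
    linarith
  have := hmono (Set.mem_Ici.2 le_rfl) (Set.mem_Ici.2 ht) ht
  simp only [neg_zero, Real.exp_zero, zero_div, add_zero, mul_one] at this
  linarith

theorem sub_mul_exp_neg_sub_le (a b : ℝ) :
    (b - a) * (Real.exp (-a) - Real.exp (-b))
      ≤ (b - a) ^ 2 * ((Real.exp (-a) + Real.exp (-b)) / 2) := by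
  wlog hab : a ≤ b generalizing a b
  · linarith [this b a (le_of_not_ge hab)]
  have h := one_sub_half_le_exp_neg_mul (sub_nonneg.2 hab)
  have hb : Real.exp (-b) = Real.exp (-a) * Real.exp (-(b - a)) := by
    rw [← Real.exp_add]; ring_nf
  rw [hb]
  have := mul_le_mul_of_nonneg_left h (mul_nonneg (sub_nonneg.2 hab) (Real.exp_pos (-a)).le)
  linarith

theorem le_sub_of_step_bounds {f g : ℕ → ℝ} {K y : ℝ} (hK : 0 < K) (hy0 : 0 ≤ y)
    (hy1 : y < 1) (hg : ∀ k, (1 - y) * g k ≤ (1 + y) * g (k + 1))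
    (hf : ∀ k, 2 * y / K * g (k + 1) ≤ f k - f (k + 1)) (hg0 : 0 ≤ g 0) (N : ℕ) :
    (1 - y) * ((1 - Real.exp (-(2 * y * N))) / K * g 0) ≤ f 0 - f N := by
  set r : ℝ := (1 - y) / (1 + y) with hr
  have hr0 : 0 ≤ r := div_nonneg (by linarith) (by linarith)
  have hgr : ∀ k, r ^ k * g 0 ≤ g k := by
    intro k
    induction k with
    | zero => simp
    | succ k ih =>
      have h1 : r * g k ≤ g (k + 1) := by
        rw [hr, div_mul_eq_mul_div, div_le_iff₀ (by linarith)]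
        linarith [hg k]
      calc r ^ (k + 1) * g 0 = r * (r ^ k * g 0) := by ring
        _ ≤ r * g k := by gcongr
        _ ≤ g (k + 1) := h1
  have hfr : ∀ k, (1 - y) * ((1 - r ^ k) / K * g 0) ≤ f 0 - f k := by
    intro k
    induction k with
    | zero => simp
    | succ k ih =>
      have h1 : 2 * y / K * (r ^ (k + 1) * g 0) ≤ f k - f (k + 1) :=
        le_trans (by gcongr; exact hgr _) (hf k)
      have h2 : (1 - y) * ((1 - r ^ (k + 1)) / K * g 0)
          = (1 - y) * ((1 - r ^ k) / K * g 0) + 2 * y / K * (r ^ (k + 1) * g 0) := by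
        have : (1 - y) * (1 - r) = 2 * y * r := by
          rw [hr]; field_simp; ring
        have h3 : (1 - y) * (1 - r ^ (k + 1)) = (1 - y) * (1 - r ^ k) + 2 * y * r ^ (k + 1) := by
          linear_combination r ^ k * this
        field_simp
        linear_combination g 0 * h3
      linarith
  refine le_trans ?_ (hfr N)
  have hre : r ≤ Real.exp (-(2 * y)) := by
    rw [hr, div_le_iff₀ (by linarith)]
    have := one_sub_half_le_exp_neg_mul (t := 2 * y) (by linarith)
    rwa [mul_div_cancel_left₀ y (two_ne_zero)] at this
  have hrN : r ^ N ≤ Real.exp (-(2 * y * N)) := by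
    calc r ^ N ≤ Real.exp (-(2 * y)) ^ N := by gcongr
      _ = _ := by rw [← Real.exp_nat_mul]; ring_nf
  have : 0 ≤ 1 - y := by linarith
  gcongr

/-- The trace of `exp (-A)`. -/
def traceExpNeg {m : ℕ} (A : Matrix (Fin m) (Fin m) ℝ) : ℝ := (NormedSpace.exp (-A)).trace

/-- The quadratic form `xᵀ exp(-A) x`. -/
def quadExpNeg {m : ℕ} (A : Matrix (Fin m) (Fin m) ℝ) (x : Fin m → ℝ) : ℝ :=
  x ⬝ᵥ NormedSpace.exp (-A) *ᵥ x

theorem exists_orthogonal_diagonalization {m : ℕ} {A : Matrix (Fin m) (Fin m) ℝ}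
    (hA : A.IsHermitian) :
    ∃ (U : Matrix (Fin m) (Fin m) ℝ) (a : Fin m → ℝ),
      Uᵀ * U = 1 ∧ U * Uᵀ = 1 ∧ A = U * diagonal a * Uᵀ := by
  have hstar : star (hA.eigenvectorUnitary : Matrix (Fin m) (Fin m) ℝ)
      = (hA.eigenvectorUnitary : Matrix (Fin m) (Fin m) ℝ)ᵀ := by
    rw [star_eq_conjTranspose, conjTranspose_eq_transpose_of_trivial]
  refine ⟨hA.eigenvectorUnitary, hA.eigenvalues, ?_, ?_, ?_⟩
  · rw [← hstar]; exact Unitary.coe_star_mul_self _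
  · rw [← hstar]; exact Unitary.coe_mul_star_self _
  · rw [← hstar]
    exact hA.spectral_theorem

section Diagonalized

variable {m : ℕ} {U V : Matrix (Fin m) (Fin m) ℝ}

theorem exp_neg_orthogonal_conj (hU : U * Uᵀ = 1) (a : Fin m → ℝ) :
    NormedSpace.exp (-(U * diagonal a * Uᵀ)) = U * diagonal (fun i => Real.exp (-a i)) * Uᵀ := by
  have hinv : U⁻¹ = Uᵀ := Matrix.inv_eq_right_inv hU
  have hunit : IsUnit U := IsUnit.of_mul_eq_one _ hU
  have hneg : -(U * diagonal a * Uᵀ) = U * diagonal (-a) * U⁻¹ := by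
    rw [hinv, ← Matrix.neg_mul, ← Matrix.mul_neg, diagonal_neg]
    rfl
  rw [hneg, Matrix.exp_conj _ _ hunit, Matrix.exp_diagonal, hinv]
  congr 3
  funext i
  rw [Pi.coe_exp, Pi.neg_apply, Real.exp_eq_exp_ℝ]

theorem traceExpNeg_orthogonal_conj (hU : U * Uᵀ = 1) (a : Fin m → ℝ) :
    traceExpNeg (U * diagonal a * Uᵀ) = ∑ i, Real.exp (-a i) := by
  rw [traceExpNeg, exp_neg_orthogonal_conj hU, trace_mul_cycle, mul_eq_one_comm.1 hU, one_mul,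
    trace_diagonal]

theorem dotProduct_orthogonal_conj_mulVec (U : Matrix (Fin m) (Fin m) ℝ) (a x : Fin m → ℝ) :
    x ⬝ᵥ (U * diagonal a * Uᵀ) *ᵥ x = ∑ i, a i * (Uᵀ *ᵥ x) i ^ 2 := by
  rw [← mulVec_mulVec, ← mulVec_mulVec, dotProduct_mulVec, ← mulVec_transpose, dotProduct]
  refine sum_congr rfl fun i _ => ?_
  rw [mulVec_diagonal]
  ring

theorem quadExpNeg_orthogonal_conj (hU : U * Uᵀ = 1) (a x : Fin m → ℝ) :
    quadExpNeg (U * diagonal a * Uᵀ) x = ∑ i, Real.exp (-a i) * (Uᵀ *ᵥ x) i ^ 2 := by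
  rw [quadExpNeg, exp_neg_orthogonal_conj hU, dotProduct_orthogonal_conj_mulVec]

theorem sum_sq_transpose_mulVec (hU : U * Uᵀ = 1) (x : Fin m → ℝ) :
    ∑ i, (Uᵀ *ᵥ x) i ^ 2 = ∑ i, x i ^ 2 := by
  have h := dotProduct_orthogonal_conj_mulVec U (fun _ => 1) x
  rw [diagonal_one, mul_one, hU, one_mulVec, dotProduct] at h
  simp only [one_mul] at h
  rw [← h]
  exact sum_congr rfl fun i _ => (sq (x i)).symm

end Diagonalized

section RankOneUpdate

variable {m : ℕ}

theorem isHermitian_vecMulVec_self (x : Fin m → ℝ) : (vecMulVec x x).IsHermitian := by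
  ext i j
  simp [vecMulVec_apply, mul_comm]

theorem traceExpNeg_nonneg {A : Matrix (Fin m) (Fin m) ℝ} (hA : A.IsHermitian) :
    0 ≤ traceExpNeg A := by
  obtain ⟨U, a, -, hU, rfl⟩ := exists_orthogonal_diagonalization hA
  rw [traceExpNeg_orthogonal_conj hU]
  positivity

theorem quadExpNeg_nonneg {A : Matrix (Fin m) (Fin m) ℝ} (hA : A.IsHermitian) (x : Fin m → ℝ) :
    0 ≤ quadExpNeg A x := by
  obtain ⟨U, a, -, hU, rfl⟩ := exists_orthogonal_diagonalization hA
  rw [quadExpNeg_orthogonal_conj hU]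
  positivity

theorem traceExpNeg_zero : traceExpNeg (0 : Matrix (Fin m) (Fin m) ℝ) = m := by
  simp [traceExpNeg]

theorem exp_neg_le_traceExpNeg {A : Matrix (Fin m) (Fin m) ℝ} (hA : A.IsHermitian)
    {v : Fin m → ℝ} (hv : ∑ i, v i ^ 2 = 1) {s : ℝ} (hs : v ⬝ᵥ A *ᵥ v < s) :
    Real.exp (-s) ≤ traceExpNeg A := by
  obtain ⟨U, a, -, hU, rfl⟩ := exists_orthogonal_diagonalization hA
  rw [dotProduct_orthogonal_conj_mulVec] at hs
  rw [traceExpNeg_orthogonal_conj hU]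
  rw [← sum_sq_transpose_mulVec hU] at hv
  obtain ⟨i, hi⟩ : ∃ i, a i < s := by
    by_contra! h
    have : s ≤ ∑ i, a i * (Uᵀ *ᵥ v) i ^ 2 := by
      calc s = ∑ i, s * (Uᵀ *ᵥ v) i ^ 2 := by rw [← mul_sum, hv, mul_one]
        _ ≤ _ := sum_le_sum fun i _ => mul_le_mul_of_nonneg_right (h i) (sq_nonneg _)
    linarith
  calc Real.exp (-s) ≤ Real.exp (-a i) := Real.exp_le_exp.2 (by linarith)
    _ ≤ _ := single_le_sum (f := fun i => Real.exp (-a i))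
      (fun j _ => (Real.exp_pos _).le) (mem_univ i)

/-- First order convexity and a trapezoidal decay bound for the trace exponential along a
rank-one perturbation, obtained by expanding in the eigenbases of both matrices. -/
theorem traceExpNeg_rankOne_update {A : Matrix (Fin m) (Fin m) ℝ} (hA : A.IsHermitian)
    (x : Fin m → ℝ) {h : ℝ} (hh : 0 < h) :
    h * quadExpNeg (A + h • vecMulVec x x) x
        ≤ traceExpNeg A - traceExpNeg (A + h • vecMulVec x x) ∧
      quadExpNeg A x - quadExpNeg (A + h • vecMulVec x x) x
        ≤ h * (∑ i, x i ^ 2) / 2 *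
          (quadExpNeg A x + quadExpNeg (A + h • vecMulVec x x) x) := by
  have hX := isHermitian_vecMulVec_self x
  have hB : (A + h • vecMulVec x x).IsHermitian := hA.add (hX.smul (IsSelfAdjoint.all h))
  obtain ⟨U, a, hU', hU, hAU⟩ := exists_orthogonal_diagonalization hA
  obtain ⟨V, b, hV', hV, hBV⟩ := exists_orthogonal_diagonalization hB
  have key : h • vecMulVec (Uᵀ *ᵥ x) (Vᵀ *ᵥ x)
      = Uᵀ * V * diagonal b - diagonal a * (Uᵀ * V) := by
    have h1 : Uᵀ * (A + h • vecMulVec x x) * V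
        = diagonal a * (Uᵀ * V) + h • vecMulVec (Uᵀ *ᵥ x) (Vᵀ *ᵥ x) := by
      rw [Matrix.mul_add, Matrix.add_mul, Matrix.mul_smul, Matrix.smul_mul, mul_vecMulVec,
        vecMulVec_mul, ← mulVec_transpose]
      congr 1
      rw [hAU, ← Matrix.mul_assoc, ← Matrix.mul_assoc, hU', one_mul, Matrix.mul_assoc]
    have h2 : Uᵀ * (A + h • vecMulVec x x) * V = Uᵀ * V * diagonal b := by
      rw [hBV]
      simp only [Matrix.mul_assoc]
      rw [hV', mul_one]
    rw [← h2, h1, add_sub_cancel_left]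
  set O := Uᵀ * V with hO
  set p := Uᵀ *ᵥ x with hp
  set q := Vᵀ *ᵥ x with hq
  have hOO : O * Oᵀ = 1 := by
    rw [hO, transpose_mul, transpose_transpose, Matrix.mul_assoc, ← Matrix.mul_assoc V, hV, one_mul,
      hU']
  have hO'O : Oᵀ * O = 1 := mul_eq_one_comm.1 hOO
  have hrow : ∀ i, ∑ j, O i j ^ 2 = 1 := fun i => by
    have := congrFun (congrFun hOO i) i
    rw [mul_apply, one_apply_eq] at this
    rw [← this]
    exact sum_congr rfl fun j _ => by rw [transpose_apply, sq]
  have hcol : ∀ j, ∑ i, O i j ^ 2 = 1 := fun j => by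
    have := congrFun (congrFun hO'O j) j
    rw [mul_apply, one_apply_eq] at this
    rw [← this]
    exact sum_congr rfl fun i _ => by rw [transpose_apply, sq]
  have hpq : ∀ i, p i = ∑ j, O i j * q j := fun i => by
    have : p = O *ᵥ q := by
      rw [hO, hp, hq, mulVec_mulVec, Matrix.mul_assoc, hV, mul_one]
    rw [this]; rfl
  have hqp : ∀ j, q j = ∑ i, O i j * p i := fun j => by
    have : q = Oᵀ *ᵥ p := by
      rw [hO, hp, hq, mulVec_mulVec, transpose_mul, transpose_transpose, Matrix.mul_assoc, hU,
        mul_one]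
    rw [this]; rfl
  have hent : ∀ i j, h * (p i * q j) = (b j - a i) * O i j := fun i j => by
    have := congrFun (congrFun key i) j
    rw [Matrix.smul_apply, vecMulVec_apply, Matrix.sub_apply, mul_diagonal, diagonal_mul,
      smul_eq_mul] at this
    rw [this]; ring
  have hTA : traceExpNeg A = ∑ i, ∑ j, O i j ^ 2 * Real.exp (-a i) := by
    rw [hAU, traceExpNeg_orthogonal_conj hU]
    exact sum_congr rfl fun i _ => by rw [← sum_mul, hrow, one_mul]
  have hTB : traceExpNeg (A + h • vecMulVec x x) = ∑ i, ∑ j, O i j ^ 2 * Real.exp (-b j) := by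
    rw [hBV, traceExpNeg_orthogonal_conj hV, sum_comm]
    exact sum_congr rfl fun i _ => by rw [← sum_mul, hcol, one_mul]
  have hQA : quadExpNeg A x = ∑ i, ∑ j, p i * q j * O i j * Real.exp (-a i) := by
    rw [hAU, quadExpNeg_orthogonal_conj hU]
    refine sum_congr rfl fun i _ => ?_
    rw [← hp, sq]
    nth_rewrite 2 [hpq i]
    rw [mul_sum, mul_sum]
    exact sum_congr rfl fun j _ => by ring
  have hQB : quadExpNeg (A + h • vecMulVec x x) x
      = ∑ i, ∑ j, p i * q j * O i j * Real.exp (-b j) := by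
    rw [hBV, quadExpNeg_orthogonal_conj hV, sum_comm]
    refine sum_congr rfl fun j _ => ?_
    rw [← hq, sq]
    nth_rewrite 2 [hqp j]
    rw [mul_sum, mul_sum]
    exact sum_congr rfl fun i _ => by ring
  have hQA' : (∑ i, x i ^ 2) * quadExpNeg A x
      = ∑ i, ∑ j, p i ^ 2 * q j ^ 2 * Real.exp (-a i) := by
    rw [hAU, quadExpNeg_orthogonal_conj hU, ← sum_sq_transpose_mulVec hV, sum_mul_sum, sum_comm]
    exact sum_congr rfl fun i _ => sum_congr rfl fun j _ => by ring
  have hQB' : (∑ i, x i ^ 2) * quadExpNeg (A + h • vecMulVec x x) x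
      = ∑ i, ∑ j, p i ^ 2 * q j ^ 2 * Real.exp (-b j) := by
    rw [hBV, quadExpNeg_orthogonal_conj hV, ← sum_sq_transpose_mulVec hU, sum_mul_sum]
    exact sum_congr rfl fun i _ => sum_congr rfl fun j _ => by ring
  constructor
  · rw [hTA, hTB, hQB, mul_sum, ← sum_sub_distrib]
    refine sum_le_sum fun i _ => ?_
    rw [mul_sum, ← sum_sub_distrib]
    refine sum_le_sum fun j _ => ?_
    have h1 : Real.exp (-a i) = Real.exp (-b j) * Real.exp (b j - a i) := by
      rw [← Real.exp_add]; ring_nf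
    have h2 : (b j - a i) + 1 ≤ Real.exp (b j - a i) := Real.add_one_le_exp _
    calc h * (p i * q j * O i j * Real.exp (-b j))
        = O i j ^ 2 * Real.exp (-b j) * (b j - a i) := by
          linear_combination O i j * Real.exp (-b j) * hent i j
      _ ≤ O i j ^ 2 * Real.exp (-b j) * (Real.exp (b j - a i) - 1) := by
          exact mul_le_mul_of_nonneg_left (by linarith) (by positivity)
      _ = _ := by rw [h1]; ring
  · refine le_of_mul_le_mul_left ?_ hh
    calc h * (quadExpNeg A x - quadExpNeg (A + h • vecMulVec x x) x)
        = ∑ i, ∑ j, O i j ^ 2 * ((b j - a i) * (Real.exp (-a i) - Real.exp (-b j))) := by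
          rw [hQA, hQB, ← sum_sub_distrib, mul_sum]
          refine sum_congr rfl fun i _ => ?_
          rw [← sum_sub_distrib, mul_sum]
          refine sum_congr rfl fun j _ => ?_
          linear_combination O i j * (Real.exp (-a i) - Real.exp (-b j)) * hent i j
      _ ≤ ∑ i, ∑ j, O i j ^ 2 *
            ((b j - a i) ^ 2 * ((Real.exp (-a i) + Real.exp (-b j)) / 2)) := by
          exact sum_le_sum fun i _ => sum_le_sum fun j _ =>
            mul_le_mul_of_nonneg_left (sub_mul_exp_neg_sub_le _ _) (sq_nonneg _)
      _ = h ^ 2 / 2 * ((∑ i, x i ^ 2) * quadExpNeg A x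
            + (∑ i, x i ^ 2) * quadExpNeg (A + h • vecMulVec x x) x) := by
          rw [hQA', hQB', ← sum_add_distrib, mul_sum]
          refine sum_congr rfl fun i _ => ?_
          rw [← sum_add_distrib, mul_sum]
          refine sum_congr rfl fun j _ => ?_
          linear_combination -(h * (p i * q j) + (b j - a i) * O i j)
            * ((Real.exp (-a i) + Real.exp (-b j)) / 2) * hent i j
      _ = _ := by ring

/-- A one-step matrix Laplace transform bound for a rank-one positive semidefinite update. -/
theorem traceExpNeg_add_rankOne_le {A : Matrix (Fin m) (Fin m) ℝ} (hA : A.IsHermitian)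
    {x : Fin m → ℝ} {K θ : ℝ} (hK : 0 < K) (hx : ∑ i, x i ^ 2 ≤ K) (hθ : 0 < θ) :
    traceExpNeg (A + θ • vecMulVec x x)
      ≤ traceExpNeg A - (1 - Real.exp (-(θ * K))) / K * quadExpNeg A x := by
  have hX := isHermitian_vecMulVec_self x
  set D := traceExpNeg A - traceExpNeg (A + θ • vecMulVec x x) with hD
  set C := (1 - Real.exp (-(θ * K))) / K * quadExpNeg A x with hC
  have hstep : ∀ᶠ N : ℕ in Filter.atTop, (1 - θ * K / 2 / N) * C ≤ D := by
    have hlim : Filter.Tendsto (fun N : ℕ => θ * K / 2 / (N : ℝ)) Filter.atTop (nhds 0) :=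
      tendsto_const_div_atTop_nhds_zero_nat _
    filter_upwards [hlim.eventually_lt_const one_pos, Filter.eventually_gt_atTop 0] with N hN hN0
    have hNpos : (0 : ℝ) < N := Nat.cast_pos.2 hN0
    set B : ℕ → Matrix (Fin m) (Fin m) ℝ := fun k => A + (k * (θ / N)) • vecMulVec x x with hBdef
    have hB : ∀ k, (B k).IsHermitian := fun k => hA.add (hX.smul (IsSelfAdjoint.all _))
    have hBs : ∀ k, B (k + 1) = B k + (θ / N) • vecMulVec x x := fun k => by
      simp only [hBdef, add_assoc, ← add_smul]
      push_cast
      ring_nf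
    have hup := fun k => traceExpNeg_rankOne_update (hB k) x (h := θ / N) (by positivity)
    have h := le_sub_of_step_bounds (f := fun k => traceExpNeg (B k))
      (g := fun k => quadExpNeg (B k) x) (K := K) (y := θ * K / 2 / N) hK (by positivity) hN
      (fun k => ?_) (fun k => ?_) (quadExpNeg_nonneg (hB 0) x) N
    · have h0 : B 0 = A := by simp [hBdef]
      have h1 : B N = A + θ • vecMulVec x x := by
        simp only [hBdef]
        rw [mul_div_cancel₀ _ hNpos.ne']
      have h2 : 2 * (θ * K / 2 / N) * N = θ * K := by field_simp
      simp only [h0, h1, h2] at h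
      exact h
    · have h1 := (hup k).2
      rw [← hBs] at h1
      have h2 : θ / N * (∑ i, x i ^ 2) / 2 * (quadExpNeg (B k) x + quadExpNeg (B (k + 1)) x)
          ≤ θ / N * K / 2 * (quadExpNeg (B k) x + quadExpNeg (B (k + 1)) x) := by
        have := quadExpNeg_nonneg (hB k) x
        have := quadExpNeg_nonneg (hB (k + 1)) x
        gcongr
      have h3 : θ * K / 2 / N = θ / N * K / 2 := by ring
      simp only [h3]
      linarith
    · have h1 := (hup k).1
      rw [← hBs] at h1
      have h3 : 2 * (θ * K / 2 / N) / K = θ / N := by field_simp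
      simp only [h3]
      exact h1
  have hlim : Filter.Tendsto (fun N : ℕ => (1 - θ * K / 2 / (N : ℝ)) * C) Filter.atTop
      (nhds ((1 - 0) * C)) :=
    ((tendsto_const_div_atTop_nhds_zero_nat _).const_sub 1).mul_const C
  have := le_of_tendsto hlim hstep
  linarith

end RankOneUpdate

section Expectation

variable {𝓧 : Type*} [MeasurableSpace 𝓧] {m : ℕ}

theorem continuous_exp_neg :
    Continuous fun A : Matrix (Fin m) (Fin m) ℝ => NormedSpace.exp (-A) := by
  let _ : NormedRing (Matrix (Fin m) (Fin m) ℝ) := Matrix.linftyOpNormedRing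
  let _ : NormedAlgebra ℝ (Matrix (Fin m) (Fin m) ℝ) := Matrix.linftyOpNormedAlgebra
  let _ : NormedAlgebra ℚ (Matrix (Fin m) (Fin m) ℝ) := NormedAlgebra.restrictScalars ℚ ℝ _
  exact NormedSpace.exp_continuous.comp continuous_neg

theorem measurable_traceExpNeg {M : 𝓧 → Matrix (Fin m) (Fin m) ℝ}
    (hM : ∀ i j, Measurable fun x => M x i j) : Measurable fun x => traceExpNeg (M x) := by
  have hcont : Continuous fun v : Fin m → Fin m → ℝ => traceExpNeg (Matrix.of v) := by
    have h : Continuous fun A : Matrix (Fin m) (Fin m) ℝ => traceExpNeg A :=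
      continuous_exp_neg.matrix_trace
    exact h
  exact hcont.measurable.comp
    (measurable_pi_lambda _ fun i => measurable_pi_lambda _ fun j => hM i j)

variable {ν : Measure 𝓧} [IsProbabilityMeasure ν] {ξ : 𝓧 → Fin m → ℝ} {K : ℝ}

theorem integrable_mul_of_sum_sq_le (hξ : ∀ j, Measurable fun x => ξ x j)
    (hξK : ∀ x, ∑ j, ξ x j ^ 2 ≤ K) (i j : Fin m) : Integrable (fun x => ξ x i * ξ x j) ν := by
  refine Integrable.of_bound ((hξ i).mul (hξ j)).aestronglyMeasurable K
    (ae_of_all _ fun x => ?_)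
  have hi : ξ x i ^ 2 ≤ K := le_trans
    (single_le_sum (f := fun j => ξ x j ^ 2) (fun _ _ => sq_nonneg _) (mem_univ i)) (hξK x)
  have hj : ξ x j ^ 2 ≤ K := le_trans
    (single_le_sum (f := fun j => ξ x j ^ 2) (fun _ _ => sq_nonneg _) (mem_univ j)) (hξK x)
  rw [Real.norm_eq_abs, abs_le]
  constructor <;> nlinarith [sq_nonneg (ξ x i + ξ x j), sq_nonneg (ξ x i - ξ x j)]

theorem quadExpNeg_eq_sum (A : Matrix (Fin m) (Fin m) ℝ) (x : Fin m → ℝ) :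
    quadExpNeg A x = ∑ i, ∑ j, NormedSpace.exp (-A) i j * (x i * x j) := by
  rw [quadExpNeg, dotProduct]
  refine sum_congr rfl fun i _ => ?_
  rw [mulVec, dotProduct, mul_sum]
  exact sum_congr rfl fun j _ => by ring

theorem integrable_quadExpNeg (hξ : ∀ j, Measurable fun x => ξ x j)
    (hξK : ∀ x, ∑ j, ξ x j ^ 2 ≤ K) (A : Matrix (Fin m) (Fin m) ℝ) :
    Integrable (fun x => quadExpNeg A (ξ x)) ν := by
  simp only [quadExpNeg_eq_sum]
  exact integrable_finsetSum _ fun i _ => integrable_finsetSum _ fun j _ =>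
    (integrable_mul_of_sum_sq_le hξ hξK i j).const_mul _

theorem integral_quadExpNeg (hξ : ∀ j, Measurable fun x => ξ x j)
    (hξK : ∀ x, ∑ j, ξ x j ^ 2 ≤ K)
    (hiso : ∀ i j, ∫ x, ξ x i * ξ x j ∂ν = if i = j then (1 : ℝ) else 0)
    (A : Matrix (Fin m) (Fin m) ℝ) : ∫ x, quadExpNeg A (ξ x) ∂ν = traceExpNeg A := by
  have hint : ∀ i j, Integrable (fun x => NormedSpace.exp (-A) i j * (ξ x i * ξ x j)) ν :=
    fun i j => (integrable_mul_of_sum_sq_le hξ hξK i j).const_mul _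
  simp only [quadExpNeg_eq_sum]
  rw [integral_finsetSum _ fun i _ => integrable_finsetSum _ fun j _ => hint i j, traceExpNeg,
    trace]
  refine sum_congr rfl fun i _ => ?_
  rw [integral_finsetSum _ fun j _ => hint i j]
  simp [integral_const_mul, hiso]

theorem lintegral_traceExpNeg_add_rankOne_le (hξ : ∀ j, Measurable fun x => ξ x j)
    (hK : 0 < K) (hξK : ∀ x, ∑ j, ξ x j ^ 2 ≤ K)
    (hiso : ∀ i j, ∫ x, ξ x i * ξ x j ∂ν = if i = j then (1 : ℝ) else 0)
    {A : Matrix (Fin m) (Fin m) ℝ} (hA : A.IsHermitian) {θ : ℝ} (hθ : 0 < θ) :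
    ∫⁻ x, ENNReal.ofReal (traceExpNeg (A + θ • vecMulVec (ξ x) (ξ x))) ∂ν
      ≤ ENNReal.ofReal (Real.exp (-((1 - Real.exp (-(θ * K))) / K)) * traceExpNeg A) := by
  set κ := (1 - Real.exp (-(θ * K))) / K with hκ
  have hX := fun x => isHermitian_vecMulVec_self (ξ x)
  have hle : ∀ x, traceExpNeg (A + θ • vecMulVec (ξ x) (ξ x))
      ≤ traceExpNeg A - κ * quadExpNeg A (ξ x) :=
    fun x => traceExpNeg_add_rankOne_le hA hK (hξK x) hθ
  have hint := (integrable_quadExpNeg (ν := ν) hξ hξK A).const_mul κ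
  calc ∫⁻ x, ENNReal.ofReal (traceExpNeg (A + θ • vecMulVec (ξ x) (ξ x))) ∂ν
      ≤ ∫⁻ x, ENNReal.ofReal (traceExpNeg A - κ * quadExpNeg A (ξ x)) ∂ν :=
        lintegral_mono fun x => ENNReal.ofReal_le_ofReal (hle x)
    _ = ENNReal.ofReal (∫ x, (traceExpNeg A - κ * quadExpNeg A (ξ x)) ∂ν) := by
        refine (ofReal_integral_eq_lintegral_ofReal ((integrable_const _).sub hint)
          (ae_of_all _ fun x => ?_)).symm
        exact (traceExpNeg_nonneg (hA.add ((hX x).smul (IsSelfAdjoint.all θ)))).trans (hle x)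
    _ ≤ _ := by
        refine ENNReal.ofReal_le_ofReal ?_
        rw [integral_sub (integrable_const _) hint, integral_const_mul,
          integral_quadExpNeg hξ hξK hiso, integral_const]
        have h1 := Real.add_one_le_exp (-κ)
        have h2 := mul_le_mul_of_nonneg_right h1 (traceExpNeg_nonneg hA)
        simp only [probReal_univ, one_smul]
        linarith

theorem lintegral_traceExpNeg_add_sum_le (hξ : ∀ j, Measurable fun x => ξ x j)
    (hK : 0 < K) (hξK : ∀ x, ∑ j, ξ x j ^ 2 ≤ K)
    (hiso : ∀ i j, ∫ x, ξ x i * ξ x j ∂ν = if i = j then (1 : ℝ) else 0)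
    {θ : ℝ} (hθ : 0 < θ) (n : ℕ) {A : Matrix (Fin m) (Fin m) ℝ} (hA : A.IsHermitian) :
    ∫⁻ x : Fin n → 𝓧,
        ENNReal.ofReal (traceExpNeg (A + θ • ∑ i, vecMulVec (ξ (x i)) (ξ (x i))))
        ∂(Measure.pi fun _ => ν)
      ≤ ENNReal.ofReal (Real.exp (-((1 - Real.exp (-(θ * K))) / K)) ^ n * traceExpNeg A) := by
  set c := Real.exp (-((1 - Real.exp (-(θ * K))) / K)) with hc
  have hX := fun x => isHermitian_vecMulVec_self (ξ x)
  induction n generalizing A with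
  | zero => simp
  | succ n ih =>
    have hmp := (measurePreserving_piFinSuccAbove (fun _ : Fin (n + 1) => ν) 0).symm
    rw [← hmp.lintegral_comp_emb (MeasurableEquiv.measurableEmbedding _)]
    rw [lintegral_prod]
    · calc _ = ∫⁻ y, ∫⁻ x : Fin n → 𝓧, ENNReal.ofReal (traceExpNeg
            ((A + θ • vecMulVec (ξ y) (ξ y)) + θ • ∑ i, vecMulVec (ξ (x i)) (ξ (x i))))
            ∂(Measure.pi fun _ => ν) ∂ν := by
            refine lintegral_congr fun y => lintegral_congr fun x => ?_
            rw [Fin.sum_univ_succ, smul_add, ← add_assoc]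
            rfl
        _ ≤ ∫⁻ y, ENNReal.ofReal (c ^ n * traceExpNeg (A + θ • vecMulVec (ξ y) (ξ y))) ∂ν :=
            lintegral_mono fun y => ih (hA.add ((hX y).smul (IsSelfAdjoint.all θ)))
        _ = ENNReal.ofReal (c ^ n)
              * ∫⁻ y, ENNReal.ofReal (traceExpNeg (A + θ • vecMulVec (ξ y) (ξ y))) ∂ν := by
            rw [← lintegral_const_mul' _ _ ENNReal.ofReal_ne_top]
            exact lintegral_congr fun y => ENNReal.ofReal_mul (by positivity)
        _ ≤ ENNReal.ofReal (c ^ n) * ENNReal.ofReal (c * traceExpNeg A) := by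
            gcongr
            exact lintegral_traceExpNeg_add_rankOne_le hξ hK hξK hiso hA hθ
        _ = _ := by
            rw [← ENNReal.ofReal_mul (by positivity)]
            ring_nf
    · refine Measurable.aemeasurable (ENNReal.measurable_ofReal.comp ?_)
      refine (measurable_traceExpNeg
        (M := fun x : Fin (n + 1) → 𝓧 => A + θ • ∑ i, vecMulVec (ξ (x i)) (ξ (x i)))
        fun i j => ?_).comp (MeasurableEquiv.measurable _)
      simp only [Matrix.add_apply, Matrix.smul_apply, Matrix.sum_apply, vecMulVec_apply]
      exact (Measurable.const_smul (Finset.measurable_fun_sum _ fun k _ =>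
        ((hξ i).comp (measurable_pi_apply k)).mul ((hξ j).comp (measurable_pi_apply k))) θ).const_add _

/-- Matrix Chernoff lower tail for sums of rank-one matrices built from an isotropic bounded
random vector. -/
theorem measure_exists_quadForm_lt_le (hξ : ∀ j, Measurable fun x => ξ x j)
    (hK : 0 < K) (hξK : ∀ x, ∑ j, ξ x j ^ 2 ≤ K)
    (hiso : ∀ i j, ∫ x, ξ x i * ξ x j ∂ν = if i = j then (1 : ℝ) else 0)
    (n : ℕ) {δ : ℝ} (hδ0 : 0 < δ) (hδ1 : δ < 1) :
    (Measure.pi fun _ : Fin n => ν)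
        {x | ∃ v : Fin m → ℝ, ∑ i, v i ^ 2 = 1 ∧
          v ⬝ᵥ (∑ i, vecMulVec (ξ (x i)) (ξ (x i))) *ᵥ v < n * (1 - δ)}
      ≤ ENNReal.ofReal ((m : ℝ) * Real.exp (-((n : ℝ) * cDelta δ) / K)) := by
  set θ := -Real.log (1 - δ) / K with hθdef
  have hθ : 0 < θ := div_pos (neg_pos.2 (Real.log_neg (by linarith) (by linarith))) hK
  have hθK : Real.exp (-(θ * K)) = 1 - δ := by
    rw [hθdef, div_mul_cancel₀ _ hK.ne', neg_neg, Real.exp_log (by linarith)]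
  set s := θ * (n * (1 - δ)) with hs
  set f : (Fin n → 𝓧) → ℝ≥0∞ := fun x =>
    ENNReal.ofReal (traceExpNeg (θ • ∑ i, vecMulVec (ξ (x i)) (ξ (x i)))) with hf
  have hfm : Measurable f := by
    refine ENNReal.measurable_ofReal.comp (measurable_traceExpNeg fun i j => ?_)
    simp only [Matrix.smul_apply, Matrix.sum_apply, vecMulVec_apply]
    exact Measurable.const_smul (Finset.measurable_fun_sum _ fun k _ =>
      ((hξ i).comp (measurable_pi_apply k)).mul ((hξ j).comp (measurable_pi_apply k))) θ
  have hsub : {x : Fin n → 𝓧 | ∃ v : Fin m → ℝ, ∑ i, v i ^ 2 = 1 ∧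
      v ⬝ᵥ (∑ i, vecMulVec (ξ (x i)) (ξ (x i))) *ᵥ v < n * (1 - δ)}
        ⊆ {x | ENNReal.ofReal (Real.exp (-s)) ≤ f x} := by
    rintro x ⟨v, hv, hlt⟩
    refine ENNReal.ofReal_le_ofReal (exp_neg_le_traceExpNeg ?_ hv ?_)
    · ext i j
      simp [Matrix.sum_apply, vecMulVec_apply, mul_comm]
    · rw [smul_mulVec, dotProduct_smul, smul_eq_mul, hs]
      exact mul_lt_mul_of_pos_left hlt hθ
  have hbound : ∫⁻ x, f x ∂(Measure.pi fun _ => ν)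
      ≤ ENNReal.ofReal (Real.exp (-(δ / K)) ^ n * m) := by
    have h := lintegral_traceExpNeg_add_sum_le (ν := ν) hξ hK hξK hiso hθ n
      (A := 0) isHermitian_zero
    rw [hθK, traceExpNeg_zero, sub_sub_cancel] at h
    simpa only [zero_add] using h
  calc (Measure.pi fun _ : Fin n => ν) _
      ≤ (Measure.pi fun _ => ν) {x | ENNReal.ofReal (Real.exp (-s)) ≤ f x} := measure_mono hsub
    _ ≤ (∫⁻ x, f x ∂(Measure.pi fun _ => ν)) / ENNReal.ofReal (Real.exp (-s)) :=
        meas_ge_le_lintegral_div hfm.aemeasurable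
          (ENNReal.ofReal_pos.2 (Real.exp_pos _)).ne' ENNReal.ofReal_ne_top
    _ ≤ ENNReal.ofReal (Real.exp (-(δ / K)) ^ n * m) / ENNReal.ofReal (Real.exp (-s)) := by
        gcongr
    _ = ENNReal.ofReal (Real.exp (-(δ / K)) ^ n * m / Real.exp (-s)) :=
        (ENNReal.ofReal_div_of_pos (Real.exp_pos _)).symm
    _ = _ := by
        congr 1
        rw [← Real.exp_nat_mul, mul_comm, mul_div_assoc, ← Real.exp_sub]
        congr 2
        rw [hs, hθdef, cDelta]
        field_simp
        ring

end Expectation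

theorem cDelta_pos {δ : ℝ} (hδ0 : 0 < δ) (hδ1 : δ < 1) : 0 < cDelta δ := by
  have h1 : 0 < 1 - δ := by linarith
  have h2 : Real.log (1 - δ)⁻¹ < (1 - δ)⁻¹ - 1 :=
    Real.log_lt_sub_one_of_pos (inv_pos.2 h1) fun h => by
      rw [inv_eq_one] at h
      linarith
  rw [Real.log_inv] at h2
  have h3 := mul_lt_mul_of_pos_left h2 h1
  rw [mul_sub, mul_inv_cancel₀ h1.ne'] at h3
  rw [cDelta]
  linarith

theorem isProbabilityMeasure_dens {𝓧 : Type*} [MeasurableSpace 𝓧] {μ : Measure 𝓧} {w : 𝓧 → ℝ}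
    (hw0 : ∀ x, 0 ≤ w x) (hwint : ∫ y, w y ∂μ = 1) : IsProbabilityMeasure (dens μ w) := by
  have hint : Integrable w μ := by
    by_contra h
    rw [integral_undef h] at hwint
    exact zero_ne_one hwint
  refine ⟨?_⟩
  rw [dens, withDensity_apply _ MeasurableSet.univ, Measure.restrict_univ,
    ← ofReal_integral_eq_lintegral_ofReal hint (ae_of_all _ hw0), hwint, ENNReal.ofReal_one]

end WLSDPP

open WLSDPP in
/-- matrix Chernoff bound for i.i.d. sampling from `ν = wμ`:
`P(λ_min(G^w) < 1−δ) ≤ m exp(−n c_δ / K_{w,m})`, and `≤ η` as soon as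
`n ≥ c_δ⁻¹ K_{w,m} log(m η⁻¹)`. -/
theorem statement3 {𝓧 : Type*} [MeasurableSpace 𝓧] {m n : ℕ} (hm : 0 < m) (hn : 0 < n)
    (μ : Measure 𝓧) [IsProbabilityMeasure μ]
    (φ : Fin m → 𝓧 → ℝ) (hφ : ∀ j, Measurable (φ j)) (horth : IsONB μ φ)
    (w : 𝓧 → ℝ) (hwpos : ∀ x, 0 < w x) (hw : Measurable w) (hwint : ∫ y, w y ∂μ = 1)
    (K : ℝ) (hK : 0 < K) (hKbound : ∀ x, (w x)⁻¹ * ∑ i, φ i x ^ 2 ≤ K)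
    {δ : ℝ} (hδ0 : 0 < δ) (hδ1 : δ < 1) :
    (Measure.pi fun _ : Fin n => dens μ w)
        {x | lambdaMin (gram φ w x) < 1 - δ}
      ≤ ENNReal.ofReal ((m : ℝ) * Real.exp (-((n : ℝ) * cDelta δ) / K)) ∧
    ∀ η : ℝ, 0 < η →
      (n : ℝ) ≥ (cDelta δ)⁻¹ * K * Real.log ((m : ℝ) * η⁻¹) →
      (Measure.pi fun _ : Fin n => dens μ w)
          {x | lambdaMin (gram φ w x) < 1 - δ}
        ≤ ENNReal.ofReal η := by
  have hprob : IsProbabilityMeasure (dens μ w) :=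
    isProbabilityMeasure_dens (fun x => (hwpos x).le) hwint
  set ξ : 𝓧 → Fin m → ℝ := fun x j => (Real.sqrt (w x))⁻¹ * φ j x with hξdef
  have hsq : ∀ x, (Real.sqrt (w x))⁻¹ * (Real.sqrt (w x))⁻¹ = (w x)⁻¹ := fun x => by
    rw [← mul_inv, Real.mul_self_sqrt (hwpos x).le]
  have hξ : ∀ j, Measurable fun x => ξ x j := fun j => hw.sqrt.inv.mul (hφ j)
  have hξK : ∀ x, ∑ j, ξ x j ^ 2 ≤ K := fun x => by
    refine le_of_eq_of_le ?_ (hKbound x)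
    rw [mul_sum]
    exact sum_congr rfl fun j _ => by
      rw [← hsq]
      ring
  have hiso : ∀ i j, ∫ x, ξ x i * ξ x j ∂(dens μ w) = if i = j then (1 : ℝ) else 0 := by
    intro i j
    rw [← horth i j, WLSDPP.dens, integral_withDensity_eq_integral_toReal_smul hw.ennreal_ofReal
      (ae_of_all _ fun _ => ENNReal.ofReal_lt_top)]
    refine integral_congr_ae (ae_of_all _ fun x => ?_)
    have h1 : ξ x i * ξ x j = (w x)⁻¹ * (φ i x * φ j x) := by
      rw [← hsq]
      ring
    simp only [h1]
    rw [ENNReal.toReal_ofReal (hwpos x).le, smul_eq_mul, mul_inv_cancel_left₀ (hwpos x).ne']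
  have hn' : (0 : ℝ) < n := Nat.cast_pos.2 hn
  have hgram : ∀ x : Fin n → 𝓧,
      gram φ w x = (n : ℝ)⁻¹ • ∑ i, vecMulVec (ξ (x i)) (ξ (x i)) := fun x => by
    rw [WLSDPP.gram]
    congr 1
    refine sum_congr rfl fun i _ => ?_
    ext k l
    rw [Matrix.smul_apply, vecMulVec_apply, vecMulVec_apply, smul_eq_mul, ← hsq, feat, feat, hξdef]
    ring
  have hsub : {x : Fin n → 𝓧 | lambdaMin (gram φ w x) < 1 - δ}
      ⊆ {x | ∃ v : Fin m → ℝ, ∑ i, v i ^ 2 = 1 ∧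
          v ⬝ᵥ (∑ i, vecMulVec (ξ (x i)) (ξ (x i))) *ᵥ v < n * (1 - δ)} := by
    intro x hx
    have hne : Nonempty {v : Fin m → ℝ // ∑ i, v i ^ 2 = 1} :=
      ⟨⟨Pi.single ⟨0, hm⟩ 1, by simp [Pi.single_apply]⟩⟩
    obtain ⟨⟨v, hv⟩, hlt⟩ := exists_lt_of_ciInf_lt (Set.mem_ofPred_eq ▸ hx)
    refine ⟨v, hv, ?_⟩
    simp only [hgram, smul_mulVec, dotProduct_smul, smul_eq_mul] at hlt
    rwa [inv_mul_lt_iff₀ hn'] at hlt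
  have hmain := (measure_mono hsub).trans
    (measure_exists_quadForm_lt_le (ν := dens μ w) hξ hK hξK hiso n hδ0 hδ1)
  refine ⟨hmain, fun η hη hnη => hmain.trans (ENNReal.ofReal_le_ofReal ?_)⟩
  have hc := cDelta_pos hδ0 hδ1
  have hm' : (0 : ℝ) < m := Nat.cast_pos.2 hm
  have h1 : Real.log (m * η⁻¹) ≤ n * cDelta δ / K := by
    rw [le_div_iff₀ hK]
    calc Real.log (m * η⁻¹) * K = cDelta δ * ((cDelta δ)⁻¹ * K * Real.log (m * η⁻¹)) := by
          field_simp
      _ ≤ cDelta δ * n := by gcongr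
      _ = n * cDelta δ := mul_comm _ _
  calc (m : ℝ) * Real.exp (-((n : ℝ) * cDelta δ) / K)
      ≤ m * Real.exp (-Real.log (m * η⁻¹)) := by
        rw [neg_div]
        gcongr
    _ = η := by
        rw [Real.exp_neg, Real.exp_log (by positivity)]
        field_simp
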